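/- arXiv:0807.5041 — 3 statements merged into one kernel-verified Lean document; each statement's English description precedes it below -/
import Mathlib

section
/- Let κ > 0 and θ > 0. Suppose g : ℂ \ {iκ} → ℂ is holomorphic, the function k ↦ (k−iκ)g(k) extends holomorphically to all of ℂ (so g has at most a simple pole at iκ), the residue condition lim_{k→iκ}(k−iκ)g(k) = iθ·g(−iκ) holds, and g(k) → 0 as |k| → ∞. Then g is identically zero. -/
open Complex Filter Topology

/-- Vanishing lemma for the reflectionless (one-soliton) Riemann–Hilbert problem:
if `g` is holomorphic off `iκ` with at most a simple pole at `iκ`, satisfies the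
residue condition `res_{iκ} g = iθ g(-iκ)` with `θ > 0`, and vanishes at infinity,
then `g` is identically zero. -/
theorem stmt_1 (κ θ : ℝ) (hκ : 0 < κ) (hθ : 0 < θ) (g : ℂ → ℂ)
    (hg : DifferentiableOn ℂ g {(I * (κ : ℂ))}ᶜ)
    (hext : ∃ G : ℂ → ℂ, Differentiable ℂ G ∧
      ∀ k : ℂ, k ≠ I * (κ : ℂ) → G k = (k - I * (κ : ℂ)) * g k)
    (hres : Tendsto (fun k : ℂ => (k - I * (κ : ℂ)) * g k) (𝓝[≠] (I * (κ : ℂ)))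
      (𝓝 (I * (θ : ℂ) * g (-(I * (κ : ℂ))))))
    (hinf : Tendsto g (Bornology.cobounded ℂ) (𝓝 0)) :
    ∀ k : ℂ, k ≠ I * (κ : ℂ) → g k = 0 := by
  obtain ⟨G, hG, hGg⟩ := hext
  set a : ℂ := I * (κ : ℂ) with ha
  have hκ' : (κ : ℂ) ≠ 0 := by exact_mod_cast hκ.ne'
  have hslope : ∀ k, k ≠ a → dslope G a k = g k - G a * (k - a)⁻¹ := by
    intro k hk
    have hka : k - a ≠ 0 := sub_ne_zero.2 hk
    rw [dslope_of_ne _ hk, slope_def_field, hGg k hk]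
    field_simp
  have hd : Differentiable ℂ (dslope G a) := by
    rw [← differentiableOn_univ] at hG ⊢
    exact (Complex.differentiableOn_dslope univ_mem).2 hG
  have hinv : Tendsto (fun k : ℂ => (k - a)⁻¹) (Bornology.cobounded ℂ) (𝓝 0) :=
    tendsto_inv₀_cobounded.comp (tendsto_sub_const_cobounded a)
  have hlim : Tendsto (dslope G a) (cocompact ℂ) (𝓝 0) := by
    rw [← Metric.cobounded_eq_cocompact]
    have h : Tendsto (fun k => g k - G a * (k - a)⁻¹) (Bornology.cobounded ℂ) (𝓝 0) := by
      simpa using hinf.sub (hinv.const_mul (G a))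
    refine h.congr' ?_
    filter_upwards [Bornology.eventually_ne_cobounded a] with k hk
    exact (hslope k hk).symm
  have hg_eq : ∀ k, k ≠ a → g k = G a * (k - a)⁻¹ := fun k hk =>
    sub_eq_zero.1 ((hslope k hk).symm.trans (hd.apply_eq_of_tendsto_cocompact k hlim))
  have hres' : G a = I * (θ : ℂ) * g (-a) := by
    refine tendsto_nhds_unique ?_ hres
    refine (hG.continuous.continuousAt.tendsto.mono_left nhdsWithin_le_nhds).congr' ?_
    filter_upwards [self_mem_nhdsWithin] with k hk
    exact hGg k hk
  have hne : -a ≠ a := by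
    rw [Ne, neg_eq_self]
    exact mul_ne_zero I_ne_zero hκ'
  have hsum : ((2 * κ + θ : ℝ) : ℂ) ≠ 0 := by
    exact_mod_cast (by positivity : (2 * κ + θ : ℝ) ≠ 0)
  have hA : G a = 0 := by
    have h := hres'
    rw [hg_eq _ hne] at h
    have h2 : -a - a ≠ 0 := sub_ne_zero.2 hne
    have h3 : G a * (-a - a) = I * (θ : ℂ) * G a := by
      calc G a * (-a - a) = I * (θ : ℂ) * (G a * (-a - a)⁻¹) * (-a - a) := by rw [← h]
        _ = I * (θ : ℂ) * G a := by
          linear_combination (I * (θ : ℂ) * G a) * inv_mul_cancel₀ h2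
    have h4 : I * ((2 * κ + θ : ℝ) : ℂ) * G a = 0 := by
      push_cast
      linear_combination -h3 - 2 * G a * ha
    exact (mul_eq_zero.1 h4).resolve_left (mul_ne_zero I_ne_zero hsum)
  intro k hk
  rw [hg_eq k hk, hA, zero_mul]
end

section
/- Let κ > 0 and θ > 0. Suppose f₁ and f₂ are both holomorphic on ℂ \ {iκ}, for each of them k ↦ (k−iκ)f_j(k) extends holomorphically to ℂ, each satisfies the residue condition lim_{k→iκ}(k−iκ)f_j(k) = iθ·f_j(−iκ), and f_j(k) → 1 as |k| → ∞. Then f₁ = f₂ on ℂ \ {iκ}. -/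
open Complex Filter Topology

/-- An entire function that grows slower than linearly at infinity is constant. -/
theorem Differentiable.eq_of_tendsto_div_sub {G : ℂ → ℂ} (hG : Differentiable ℂ G) (a : ℂ)
    (h : Tendsto (fun k => G k / (k - a)) (Bornology.cobounded ℂ) (𝓝 0)) (k : ℂ) :
    G k = G a := by
  have hd : Differentiable ℂ (dslope G a) := by
    rw [← differentiableOn_univ] at hG ⊢
    exact (differentiableOn_dslope univ_mem).2 hG
  have hinv : Tendsto (fun k : ℂ => (k - a)⁻¹) (Bornology.cobounded ℂ) (𝓝 0) :=
    tendsto_inv₀_cobounded.comp (tendsto_sub_const_cobounded a)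
  have hlim : Tendsto (dslope G a) (cocompact ℂ) (𝓝 0) := by
    rw [← Metric.cobounded_eq_cocompact]
    have h' := h.sub (hinv.const_mul (G a))
    rw [mul_zero, sub_zero] at h'
    refine h'.congr' ?_
    filter_upwards [Bornology.eventually_ne_cobounded a] with k hk
    rw [dslope_of_ne _ hk, slope_def_field, sub_div, div_eq_mul_inv (G a)]
  have hzero := hd.apply_eq_of_tendsto_cocompact k hlim
  have hsub := sub_smul_dslope G a k
  rw [hzero, smul_zero] at hsub
  exact sub_eq_zero.1 hsub.symm

/-- Uniqueness of the one-soliton solution of the reflectionless Riemann–Hilbert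
problem: two functions holomorphic off `iκ`, with at most a simple pole at `iκ`,
satisfying the residue condition with `θ > 0` and tending to `1` at infinity,
coincide on `ℂ \ {iκ}`. -/
theorem stmt_2 (κ θ : ℝ) (hκ : 0 < κ) (hθ : 0 < θ) (f₁ f₂ : ℂ → ℂ)
    (hf₁ : DifferentiableOn ℂ f₁ {(I * (κ : ℂ))}ᶜ)
    (hf₂ : DifferentiableOn ℂ f₂ {(I * (κ : ℂ))}ᶜ)
    (hext₁ : ∃ F : ℂ → ℂ, Differentiable ℂ F ∧
      ∀ k : ℂ, k ≠ I * (κ : ℂ) → F k = (k - I * (κ : ℂ)) * f₁ k)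
    (hext₂ : ∃ F : ℂ → ℂ, Differentiable ℂ F ∧
      ∀ k : ℂ, k ≠ I * (κ : ℂ) → F k = (k - I * (κ : ℂ)) * f₂ k)
    (hres₁ : Tendsto (fun k : ℂ => (k - I * (κ : ℂ)) * f₁ k) (𝓝[≠] (I * (κ : ℂ)))
      (𝓝 (I * (θ : ℂ) * f₁ (-(I * (κ : ℂ))))))
    (hres₂ : Tendsto (fun k : ℂ => (k - I * (κ : ℂ)) * f₂ k) (𝓝[≠] (I * (κ : ℂ)))
      (𝓝 (I * (θ : ℂ) * f₂ (-(I * (κ : ℂ))))))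
    (hinf₁ : Tendsto f₁ (Bornology.cobounded ℂ) (𝓝 1))
    (hinf₂ : Tendsto f₂ (Bornology.cobounded ℂ) (𝓝 1)) :
    ∀ k : ℂ, k ≠ I * (κ : ℂ) → f₁ k = f₂ k := by
  obtain ⟨F₁, hF₁, hF₁f⟩ := hext₁
  obtain ⟨F₂, hF₂, hF₂f⟩ := hext₂
  set a : ℂ := I * (κ : ℂ) with ha
  have value_at_pole {F f : ℂ → ℂ} {c : ℂ} (hF : Differentiable ℂ F)
      (hFf : ∀ k, k ≠ a → F k = (k - a) * f k)
      (hres : Tendsto (fun k => (k - a) * f k) (𝓝[≠] a) (𝓝 c)) : F a = c := by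
    refine tendsto_nhds_unique (hF.continuous.continuousAt.tendsto.mono_left nhdsWithin_le_nhds)
      (hres.congr' ?_)
    filter_upwards [self_mem_nhdsWithin] with k hk using (hFf k hk).symm
  have h₁ := value_at_pole hF₁ hF₁f hres₁
  have h₂ := value_at_pole hF₂ hF₂f hres₂
  have hGf (k : ℂ) (hk : k ≠ a) : (F₁ - F₂) k = (k - a) * (f₁ k - f₂ k) := by
    rw [Pi.sub_apply, hF₁f k hk, hF₂f k hk, mul_sub]
  have hconst := (hF₁.sub hF₂).eq_of_tendsto_div_sub a <| by
    have h := hinf₁.sub hinf₂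
    rw [sub_self] at h
    refine h.congr' ?_
    filter_upwards [Bornology.eventually_ne_cobounded a] with k hk
    rw [hGf k hk, mul_div_cancel_left₀ _ (sub_ne_zero.2 hk)]
  have hκ' : (κ : ℂ) ≠ 0 := ofReal_ne_zero.2 hκ.ne'
  have hne : -a ≠ a := neg_ne_self.2 (mul_ne_zero I_ne_zero hκ')
  have hGa : (F₁ - F₂) a = I * θ * (f₁ (-a) - f₂ (-a)) := by
    rw [Pi.sub_apply, h₁, h₂, mul_sub]
  have hsum : I * ((θ + 2 * κ : ℝ) : ℂ) * (f₁ (-a) - f₂ (-a)) = 0 := by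
    have h := (hGf (-a) hne).symm.trans ((hconst (-a)).trans hGa)
    push_cast
    rw [ha] at h ⊢
    linear_combination -h
  have hzero : f₁ (-a) - f₂ (-a) = 0 :=
    (mul_eq_zero.1 hsum).resolve_left
      (mul_ne_zero I_ne_zero (ofReal_ne_zero.2 (by positivity)))
  intro k hk
  have hk0 : (k - a) * (f₁ k - f₂ k) = 0 := by
    rw [← hGf k hk, hconst k, hGa, hzero, mul_zero]
  exact sub_eq_zero.1 ((mul_eq_zero.1 hk0).resolve_left (sub_ne_zero.2 hk))
end

section
/- Let 0 < κ₁ < … < κ_N, let k₀ > 0, and let h : [−k₀, k₀] → ℝ be integrable. Define T(k) = ( ∏_{j=1}^N (k+iκ_j)/(k−iκ_j) ) · exp( (1/(2πi)) ∫_{−k₀}^{k₀} h(ζ)/(ζ−k) dζ ) for k off [−k₀,k₀] and off {±iκ_j}. Then lim_{y→+∞} y·(T(iy) − 1) = ∑_{j=1}^N 2κ_j + (1/(2π)) ∫_{−k₀}^{k₀} h(ζ) dζ. -/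
open Complex Filter Topology MeasureTheory

lemma tendsto_ofReal_inv_atTop_zero :
    Tendsto (fun y : ℝ => ((y⁻¹ : ℝ) : ℂ)) atTop (𝓝 0) := by
  simpa only [Complex.ofReal_zero, Function.comp_def] using
    (Complex.continuous_ofReal.tendsto 0).comp (tendsto_inv_atTop_zero (𝕜 := ℝ))

/-- If `y (f y - 1) → a` as `y → ∞`, then `f y → 1`. -/
lemma tendsto_one_of_tendsto_mul_sub_one {f : ℝ → ℂ} {a : ℂ}
    (hf : Tendsto (fun y : ℝ => (y : ℂ) * (f y - 1)) atTop (𝓝 a)) :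
    Tendsto f atTop (𝓝 1) := by
  have hlim := (tendsto_ofReal_inv_atTop_zero.mul hf).add_const 1
  rw [zero_mul, zero_add] at hlim
  refine hlim.congr' ?_
  filter_upwards [eventually_gt_atTop 0] with y hy
  have hy' : (y : ℂ) ≠ 0 := by exact_mod_cast hy.ne'
  push_cast
  field_simp
  ring

/-- First-order coefficients at infinity add under multiplication. -/
lemma tendsto_mul_mul_sub_one {f g : ℝ → ℂ} {a b : ℂ}
    (hf : Tendsto (fun y : ℝ => (y : ℂ) * (f y - 1)) atTop (𝓝 a))
    (hg : Tendsto (fun y : ℝ => (y : ℂ) * (g y - 1)) atTop (𝓝 b)) :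
    Tendsto (fun y : ℝ => (y : ℂ) * (f y * g y - 1)) atTop (𝓝 (a + b)) := by
  have hlim := (hf.mul (tendsto_one_of_tendsto_mul_sub_one hg)).add hg
  rw [mul_one] at hlim
  exact hlim.congr fun y => by ring

/-- First-order coefficients at infinity add over finite products. -/
lemma tendsto_mul_prod_sub_one {ι : Type*} (s : Finset ι) {f : ι → ℝ → ℂ} {a : ι → ℂ}
    (hf : ∀ i ∈ s, Tendsto (fun y : ℝ => (y : ℂ) * (f i y - 1)) atTop (𝓝 (a i))) :
    Tendsto (fun y : ℝ => (y : ℂ) * ((∏ i ∈ s, f i y) - 1)) atTop (𝓝 (∑ i ∈ s, a i)) := by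
  classical
  induction s using Finset.induction_on with
  | empty => simp
  | insert i s hi ih =>
    simp only [Finset.prod_insert hi, Finset.sum_insert hi]
    exact tendsto_mul_mul_sub_one (hf i (Finset.mem_insert_self i s))
      (ih fun j hj => hf j (Finset.mem_insert_of_mem hj))

/-- If `y g(y) → b` as `y → ∞`, then `y (exp (g y) - 1) → b`. -/
lemma tendsto_mul_exp_sub_one {g : ℝ → ℂ} {b : ℂ}
    (hg : Tendsto (fun y : ℝ => (y : ℂ) * g y) atTop (𝓝 b)) :
    Tendsto (fun y : ℝ => (y : ℂ) * (Complex.exp (g y) - 1)) atTop (𝓝 b) := by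
  have hg₀ : Tendsto g atTop (𝓝 0) := by
    have h1 := tendsto_one_of_tendsto_mul_sub_one (f := fun y => g y + 1) (a := b)
      (by simpa using hg)
    simpa using h1.sub_const 1
  have hcont : ContinuousAt (dslope Complex.exp 0) 0 :=
    continuousAt_dslope_same.2 Complex.differentiableAt_exp
  have hslope : Tendsto (fun y => dslope Complex.exp 0 (g y)) atTop (𝓝 1) := by
    simpa [ContinuousAt, Function.comp_def] using hcont.tendsto.comp hg₀
  have hlim := hg.mul hslope
  rw [mul_one] at hlim
  refine hlim.congr fun y => ?_
  have := sub_smul_dslope Complex.exp 0 (g y)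
  simp only [sub_zero, smul_eq_mul, Complex.exp_zero] at this
  rw [mul_assoc, this]

/-- The Blaschke-type factor `(k + iκ) / (k - iκ)` has first-order coefficient `2κ` along the
positive imaginary axis. -/
lemma tendsto_mul_div_sub_one (c : ℝ) :
    Tendsto (fun y : ℝ => (y : ℂ) * ((I * y + I * c) / (I * y - I * c) - 1)) atTop
      (𝓝 ((2 * c : ℝ) : ℂ)) := by
  have hinv : Tendsto (fun y : ℝ => (y - c)⁻¹) atTop (𝓝 0) :=
    tendsto_inv_atTop_zero.comp (tendsto_atTop_add_const_right _ (-c) tendsto_id)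
  have hreal : Tendsto (fun y : ℝ => 2 * c + 2 * c ^ 2 * (y - c)⁻¹) atTop (𝓝 (2 * c)) := by
    simpa using (hinv.const_mul (2 * c ^ 2)).const_add (2 * c)
  refine ((Complex.continuous_ofReal.tendsto _).comp hreal).congr' ?_
  filter_upwards [eventually_gt_atTop c] with y hy
  have hy' : (y : ℂ) - c ≠ 0 := by exact_mod_cast (sub_pos.2 hy).ne'
  rw [← mul_add, ← mul_sub, mul_div_mul_left _ _ I_ne_zero]
  simp only [Function.comp_apply]
  push_cast
  field_simp
  ring

lemma tendsto_div_sub_I_mul (x : ℝ) :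
    Tendsto (fun y : ℝ => (y : ℂ) / ((x : ℂ) - I * y)) atTop (𝓝 I) := by
  have hlim : Tendsto (fun y : ℝ => ((x : ℂ) * ((y⁻¹ : ℝ) : ℂ) - I)⁻¹) atTop (𝓝 I) := by
    have := ((tendsto_ofReal_inv_atTop_zero.const_mul (x : ℂ)).sub_const I).inv₀ (by simp)
    simpa [Complex.inv_I] using this
  refine hlim.congr' ?_
  filter_upwards [eventually_gt_atTop 0] with y hy
  have hy' : (y : ℂ) ≠ 0 := by exact_mod_cast hy.ne'
  have : (x : ℂ) - I * y = y * (x * ((y⁻¹ : ℝ) : ℂ) - I) := by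
    push_cast
    field_simp
  rw [this, div_mul_eq_div_div, div_self hy', one_div]

lemma norm_div_sub_I_mul_le_one (x y : ℝ) : ‖(y : ℂ) / ((x : ℂ) - I * y)‖ ≤ 1 := by
  rw [norm_div]
  refine div_le_one_of_le₀ ?_ (norm_nonneg _)
  simpa using Complex.abs_im_le_norm ((x : ℂ) - I * y)

/-- First-order asymptotics at `i∞` of the Cauchy integral of an integrable function. -/
lemma tendsto_mul_cauchy_integral {a b : ℝ} {h : ℝ → ℝ} (hint : IntervalIntegrable h volume a b) :
    Tendsto (fun y : ℝ => (y : ℂ) * ∫ ζ in a..b, (h ζ : ℂ) / ((ζ : ℂ) - I * y)) atTop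
      (𝓝 (I * ((∫ ζ in a..b, h ζ : ℝ) : ℂ))) := by
  have hlim : Tendsto (fun y : ℝ => ∫ ζ in a..b, (h ζ : ℂ) * ((y : ℂ) / ((ζ : ℂ) - I * y))) atTop
      (𝓝 (∫ ζ in a..b, (h ζ : ℂ) * I)) := by
    refine intervalIntegral.tendsto_integral_filter_of_dominated_convergence (fun ζ => ‖h ζ‖)
      (.of_forall fun y => ?_) (.of_forall fun y => .of_forall fun ζ _ => ?_) hint.norm
      (.of_forall fun ζ _ => (tendsto_div_sub_I_mul ζ).const_mul _)
    · refine (Complex.continuous_ofReal.comp_aestronglyMeasurable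
        hint.def'.aestronglyMeasurable).mul (Measurable.aestronglyMeasurable ?_)
      fun_prop
    · rw [norm_mul, Complex.norm_real]
      exact mul_le_of_le_one_right (norm_nonneg _) (norm_div_sub_I_mul_le_one ζ y)
  rw [intervalIntegral.integral_mul_const, intervalIntegral.integral_ofReal, mul_comm] at hlim
  refine hlim.congr fun y => ?_
  rw [← intervalIntegral.integral_const_mul]
  congr 1 with ζ
  ring

/-- Asymptotic expansion of the partial transmission coefficient along the
imaginary axis: `lim_{y→∞} y (T(iy) - 1) = ∑ⱼ 2κⱼ + (1/2π) ∫_{-k₀}^{k₀} h(ζ) dζ`. -/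
theorem stmt_10 (N : ℕ) (κ : Fin N → ℝ) (hκ : ∀ j, 0 < κ j) (hmono : StrictMono κ)
    (k₀ : ℝ) (hk₀ : 0 < k₀) (h : ℝ → ℝ)
    (hint : IntervalIntegrable h volume (-k₀) k₀)
    (T : ℂ → ℂ)
    (hT : ∀ k : ℂ, k ∉ (fun s : ℝ => (s : ℂ)) '' Set.Icc (-k₀) k₀ →
      (∀ j, k ≠ I * (κ j : ℂ) ∧ k ≠ -(I * (κ j : ℂ))) →
      T k = (∏ j, (k + I * (κ j : ℂ)) / (k - I * (κ j : ℂ))) *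
        Complex.exp ((1 / (2 * (Real.pi : ℂ) * I)) *
          ∫ ζ in (-k₀)..k₀, (h ζ : ℂ) / ((ζ : ℂ) - k))) :
    Tendsto (fun y : ℝ => (y : ℂ) * (T (I * (y : ℂ)) - 1)) atTop
      (𝓝 (((∑ j, 2 * κ j) + (1 / (2 * Real.pi)) * ∫ ζ in (-k₀)..k₀, h ζ : ℝ) : ℂ)) := by
  have hexp : Tendsto (fun y : ℝ => (y : ℂ) * ((1 / (2 * (Real.pi : ℂ) * I)) *
      ∫ ζ in (-k₀)..k₀, (h ζ : ℂ) / ((ζ : ℂ) - I * y))) atTop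
      (𝓝 (((1 / (2 * Real.pi)) * ∫ ζ in (-k₀)..k₀, h ζ : ℝ) : ℂ)) := by
    have hlim := (tendsto_mul_cauchy_integral hint).const_mul (1 / (2 * (Real.pi : ℂ) * I))
    have hval : 1 / (2 * (Real.pi : ℂ) * I) * (I * ((∫ ζ in (-k₀)..k₀, h ζ : ℝ) : ℂ)) =
        (((1 / (2 * Real.pi)) * ∫ ζ in (-k₀)..k₀, h ζ : ℝ) : ℂ) := by
      rw [Complex.ofReal_mul]
      push_cast
      field_simp [I_ne_zero]
    rw [hval] at hlim
    exact hlim.congr fun y => by ring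
  have hlim := tendsto_mul_mul_sub_one
    (tendsto_mul_prod_sub_one Finset.univ fun j _ => tendsto_mul_div_sub_one (κ j))
    (tendsto_mul_exp_sub_one hexp)
  rw [← Complex.ofReal_sum, ← Complex.ofReal_add] at hlim
  refine hlim.congr' ?_
  filter_upwards [eventually_gt_atTop 0,
    eventually_all.2 fun j => eventually_gt_atTop (κ j)] with y hy hyκ
  rw [hT (I * y)]
  · rintro ⟨s, -, hs⟩
    have := congrArg Complex.im hs
    simp at this
    exact hy.ne this
  · refine fun j => ⟨fun hj => ?_, fun hj => ?_⟩
    · have := congrArg Complex.im hj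
      simp at this
      exact (hyκ j).ne' this
    · have := congrArg Complex.im hj
      simp at this
      linarith [hκ j]
end
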